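/- Under the standing setup, assume additionally that N_4(xy) is an independent set, and let H be a connected component of the subgraph induced by N_5(xy). Then: (i) every vertex u ∈ N_4 that has a neighbor in H is adjacent to every vertex of H; (ii) H is a single vertex or a single edge. -/

import Mathlib

open SimpleGraph

/-- `M` is a dominating induced matching (d.i.m.) of `G`: every edge of `G` shares an
endpoint with exactly one edge of `M`. -/
def IsDIM {V : Type*} (G : SimpleGraph V) (M : Set (Sym2 V)) : Prop :=
  M ⊆ G.edgeSet ∧ ∀ e ∈ G.edgeSet, ∃! f, f ∈ M ∧ ∃ v, v ∈ e ∧ v ∈ f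

/-- `V(M)`: the set of endpoints of edges of `M`. -/
def MVerts {V : Type*} (M : Set (Sym2 V)) : Set V := {v | ∃ e ∈ M, v ∈ e}

/-- The distance level `N_i(xy) = {z | dist(z,{x,y}) = i}`. -/
def distLevel {V : Type*} (G : SimpleGraph V) (x y : V) (i : ℕ) : Set V :=
  {z : V | min (G.dist z x) (G.dist z y) = i}

/-- `c` lists the vertices of a chordless (induced) cycle of length `n` in `G`. -/
def IsInducedCycle {V : Type*} (G : SimpleGraph V) (n : ℕ) (c : ZMod n → V) : Prop :=
  Function.Injective c ∧ ∀ i j : ZMod n, G.Adj (c i) (c j) ↔ (j = i + 1 ∨ i = j + 1)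

/-- The diamond: vertices 0,1,2,3 and edges 01,02,12,13,23 (mid-edge 12). -/
def diamondGraph : SimpleGraph (Fin 4) :=
  SimpleGraph.fromEdgeSet {s(0,1), s(0,2), s(1,2), s(1,3), s(2,3)}

/-- The butterfly: vertices 0,1,2,3,4 and edges 01,02,12,23,24,34. -/
def butterflyGraph : SimpleGraph (Fin 5) :=
  SimpleGraph.fromEdgeSet {s(0,1), s(0,2), s(1,2), s(2,3), s(2,4), s(3,4)}

/-- The gem: a path 0-1-2-3 plus the universal vertex 4. -/
def gemGraph : SimpleGraph (Fin 5) :=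
  SimpleGraph.fromEdgeSet {s(0,1), s(1,2), s(2,3), s(4,0), s(4,1), s(4,2), s(4,3)}

/-- `T_w`: the vertices of `N_3(xy)` whose neighborhood in `N_2(xy)` is exactly `{w}`. -/
def Tset {V : Type*} (G : SimpleGraph V) (x y : V) (w : V) : Set V :=
  {t | t ∈ distLevel G x y 3 ∧ G.neighborSet t ∩ distLevel G x y 2 = {w}}

/-- The vertices distinct from and nonadjacent to both `t1` and `t2`
(the vertex set of `G'`). -/
def avoidSet {V : Type*} (G : SimpleGraph V) (t1 t2 : V) : Set V :=
  {v | v ≠ t1 ∧ v ≠ t2 ∧ ¬ G.Adj v t1 ∧ ¬ G.Adj v t2}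

/-- The distance from `z` to the pair `{x, y}`. -/
noncomputable def pairDist {V : Type*} (G : SimpleGraph V) (x y z : V) : ℕ :=
  min (G.dist z x) (G.dist z y)

lemma pairDist_le_add_one {V : Type*} {G : SimpleGraph V} (hconn : G.Connected)
    (x y : V) {z w : V} (h : G.Adj z w) : pairDist G x y z ≤ pairDist G x y w + 1 := by
  have h1 := hconn.dist_triangle (u := z) (v := w) (w := x)
  have h2 := hconn.dist_triangle (u := z) (v := w) (w := y)
  rw [SimpleGraph.dist_eq_one_iff_adj.mpr h] at h1 h2
  unfold pairDist
  omega

lemma exists_adj_dist_eq {V : Type*} {G : SimpleGraph V} (hconn : G.Connected)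
    {z t : V} {n : ℕ} (h : G.dist z t = n + 1) : ∃ w, G.Adj z w ∧ G.dist w t = n := by
  obtain ⟨p, hp⟩ := hconn.exists_walk_length_eq_dist z t
  cases p with
  | nil => simp at h
  | cons hadj q =>
    rename_i w
    refine ⟨w, hadj, ?_⟩
    have h1 := SimpleGraph.dist_le q
    have h2 := hconn.dist_triangle (u := z) (v := w) (w := t)
    rw [SimpleGraph.dist_eq_one_iff_adj.mpr hadj] at h2
    rw [SimpleGraph.Walk.length_cons] at hp
    omega

lemma exists_adj_pairDist_eq {V : Type*} {G : SimpleGraph V} (hconn : G.Connected)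
    {x y z : V} {n : ℕ} (h : pairDist G x y z = n + 1) :
    ∃ w, G.Adj z w ∧ pairDist G x y w = n := by
  have key : ∀ w, G.Adj z w → (G.dist w x = n ∨ G.dist w y = n) →
      G.Adj z w ∧ pairDist G x y w = n := by
    intro w hw hd
    have := pairDist_le_add_one hconn x y hw
    refine ⟨hw, ?_⟩
    unfold pairDist at *
    omega
  rcases min_choice (G.dist z x) (G.dist z y) with hm | hm
  · obtain ⟨w, hw, hd⟩ := exists_adj_dist_eq hconn (hm.symm.trans h)
    exact ⟨w, key w hw (Or.inl hd)⟩
  · obtain ⟨w, hw, hd⟩ := exists_adj_dist_eq hconn (hm.symm.trans h)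
    exact ⟨w, key w hw (Or.inr hd)⟩

lemma pairDist_eq_zero_iff {V : Type*} {G : SimpleGraph V} (hconn : G.Connected)
    {x y z : V} : pairDist G x y z = 0 ↔ z = x ∨ z = y := by
  rw [← hconn.dist_eq_zero_iff (v := x), ← hconn.dist_eq_zero_iff (v := y)]
  unfold pairDist
  omega

/-- A graph embedding can be checked on ordered pairs. -/
lemma nonempty_embedding_of_lt {V : Type*} {G : SimpleGraph V} {n : ℕ}
    (K : SimpleGraph (Fin n)) (f : Fin n → V)
    (h : ∀ i j, i < j → f i ≠ f j ∧ (G.Adj (f i) (f j) ↔ K.Adj i j)) : Nonempty (K ↪g G) := by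
  refine ⟨⟨⟨f, fun i j hij => ?_⟩, fun {i j} => ?_⟩⟩
  · rcases lt_trichotomy i j with hlt | heq | hgt
    · exact absurd hij (h i j hlt).1
    · exact heq
    · exact absurd hij.symm (h j i hgt).1
  · rcases lt_trichotomy i j with hlt | rfl | hgt
    · exact (h i j hlt).2
    · simp
    · rw [G.adj_comm, K.adj_comm]
      exact (h j i hgt).2

lemma adj_of_diamond_free {V : Type*} {G : SimpleGraph V}
    (hDia : IsEmpty (diamondGraph ↪g G)) {a b c d : V} (hab : G.Adj a b) (hac : G.Adj a c)
    (hbc : G.Adj b c) (hbd : G.Adj b d) (hcd : G.Adj c d) (hne : a ≠ d) : G.Adj a d := by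
  by_contra hnad
  have hemb : Nonempty (diamondGraph ↪g G) := by
    apply nonempty_embedding_of_lt _ ![a, b, c, d]
    simp [Fin.forall_fin_succ, diamondGraph, hab, hac, hbc, hbd, hcd, hnad, hne, hab.ne, hac.ne,
      hbc.ne, hbd.ne, hcd.ne]
  exact hDia.elim hemb.some

lemma not_adj_of_K4_free {V : Type*} {G : SimpleGraph V}
    (hK4 : IsEmpty ((⊤ : SimpleGraph (Fin 4)) ↪g G)) {a b c d : V} (hab : G.Adj a b)
    (hac : G.Adj a c) (had : G.Adj a d) (hbc : G.Adj b c) (hbd : G.Adj b d) : ¬ G.Adj c d := by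
  intro hcd
  have hemb : Nonempty ((⊤ : SimpleGraph (Fin 4)) ↪g G) := by
    apply nonempty_embedding_of_lt _ ![a, b, c, d]
    simp [Fin.forall_fin_succ, hab, hac, had, hbc, hbd, hcd, hab.ne, hac.ne, had.ne, hbc.ne,
      hbd.ne, hcd.ne]
  exact hK4.elim hemb.some

/-- Every vertex at distance two from `{x, y}` ends an induced `P₄` whose remaining vertices
are at distance at most one. -/
lemma exists_induced_path_to_pair {V : Type*} {G : SimpleGraph V} (hconn : G.Connected)
    (hDia : IsEmpty (diamondGraph ↪g G)) {x y r : V} (hxy : G.Adj x y)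
    (hrx : G.Adj r x) (hry : r ≠ y) (hrny : ¬ G.Adj r y)
    {v : V} (hv : pairDist G x y v = 2) :
    ∃ a b c, G.Adj v a ∧ G.Adj a b ∧ G.Adj b c ∧ a ≠ c ∧ ¬ G.Adj a c ∧ ¬ G.Adj v c ∧
      pairDist G x y a = 1 ∧ pairDist G x y b = 0 ∧ pairDist G x y c ≤ 1 := by
  obtain ⟨a, hva, ha⟩ := exists_adj_pairDist_eq hconn hv
  obtain ⟨b, hab, hb⟩ := exists_adj_pairDist_eq hconn (n := 0) ha
  have hx0 : pairDist G x y x = 0 := (pairDist_eq_zero_iff hconn).2 (Or.inl rfl)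
  have hy0 : pairDist G x y y = 0 := (pairDist_eq_zero_iff hconn).2 (Or.inr rfl)
  have hvx : ¬ G.Adj v x := fun h => by
    have := pairDist_le_add_one hconn x y h
    omega
  have hvy : ¬ G.Adj v y := fun h => by
    have := pairDist_le_add_one hconn x y h
    omega
  have hax : a ≠ x := by rintro rfl; omega
  have hay : a ≠ y := by rintro rfl; omega
  have hr1 : pairDist G x y r ≤ 1 := by
    have := pairDist_le_add_one hconn x y hrx
    omega
  by_cases h1 : G.Adj a x
  · by_cases h2 : G.Adj a y
    · by_cases hvr : G.Adj v r
      · refine ⟨r, x, y, hvr, hrx, hxy, hry, hrny, hvy, ?_, hx0, by omega⟩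
        have := pairDist_le_add_one hconn x y hvr
        omega
      · refine ⟨a, x, r, hva, h1, hrx.symm, ?_, ?_, hvr, ha, hx0, hr1⟩
        · rintro rfl
          exact hvr hva
        · intro har
          exact hrny (adj_of_diamond_free hDia har.symm hrx h1 h2 hxy hry)
    · exact ⟨a, x, y, hva, h1, hxy, hay, h2, hvy, ha, hx0, by omega⟩
  · rcases (pairDist_eq_zero_iff hconn).1 hb with rfl | rfl
    · exact absurd hab h1
    · exact ⟨a, b, x, hva, hab, hxy.symm, hax, h1, hvx, ha, hb, by omega⟩

/-- In the `P₈`-free case, adjacency to a vertex at distance four propagates along edges at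
distance five. -/
lemma adj_of_adj_of_P8_free {V : Type*} {G : SimpleGraph V} (hconn : G.Connected)
    (hP8 : IsEmpty (SimpleGraph.pathGraph 8 ↪g G))
    (hDia : IsEmpty (diamondGraph ↪g G)) {x y r : V} (hxy : G.Adj x y)
    (hrx : G.Adj r x) (hry : r ≠ y) (hrny : ¬ G.Adj r y)
    {w h k : V} (hw : pairDist G x y w = 4) (hh : pairDist G x y h = 5)
    (hk : pairDist G x y k = 5) (hwh : G.Adj w h) (hhk : G.Adj h k) : G.Adj w k := by
  by_contra hwk
  obtain ⟨u, hwu, hu⟩ := exists_adj_pairDist_eq hconn hw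
  obtain ⟨v, huv, hv⟩ := exists_adj_pairDist_eq hconn hu
  obtain ⟨a, b, c, hva, hab, hbc, hac, hnac, hnvc, ha, hb, hc⟩ :=
    exists_induced_path_to_pair hconn hDia hxy hrx hry hrny hv
  have hne : ∀ p q : V, pairDist G x y p < pairDist G x y q → p ≠ q := by
    rintro p q hlt rfl
    exact lt_irrefl _ hlt
  have hnadj : ∀ p q : V, pairDist G x y p + 1 < pairDist G x y q → ¬ G.Adj p q := by
    intro p q hlt hadj
    have := pairDist_le_add_one hconn x y hadj.symm
    omega
  have hemb : Nonempty (SimpleGraph.pathGraph 8 ↪g G) := by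
    apply nonempty_embedding_of_lt _ ![c, b, a, v, u, w, h, k]
    have hca : c ≠ a := hac.symm
    have hnca : ¬ G.Adj c a := fun h => hnac h.symm
    have hncv : ¬ G.Adj c v := fun h => hnvc h.symm
    simp [Fin.forall_fin_succ, SimpleGraph.pathGraph_adj, hca, hnca, hncv, hbc.symm,
      hbc.ne.symm, hab.symm, hva.symm, huv.symm, hwu.symm, hwh, hhk, hhk.ne, hwk]
    and_intros <;> first | (apply hne; omega) | (apply hnadj; omega)
  exact hP8.elim hemb.some

/-- Lemma 10: under the standing setup, if `N₄(xy)` is independent, then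
for every connected component `H` of `G[N₅]`: (i) every vertex of `N₄` with a neighbor in
`H` is adjacent to all of `H`; (ii) `H` is a single vertex or a single edge. -/
theorem stmt19 {V : Type*} [Fintype V] [DecidableEq V]
    (G : SimpleGraph V) (hconn : G.Connected)
    (hP8 : IsEmpty (SimpleGraph.pathGraph 8 ↪g G))
    (hK4 : IsEmpty ((⊤ : SimpleGraph (Fin 4)) ↪g G))
    (hDia : IsEmpty (diamondGraph ↪g G))
    (hBut : IsEmpty (butterflyGraph ↪g G))
    (M : Set (Sym2 V)) (hM : IsDIM G M)
    (x y : V) (hxy : s(x, y) ∈ M)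
    (r : V) (hrx : G.Adj r x) (hry : r ≠ y) (hrny : ¬ G.Adj r y)
    (hN4ind : ∀ a ∈ distLevel G x y 4, ∀ b ∈ distLevel G x y 4, ¬ G.Adj a b) :
    ∀ H : (G.induce (distLevel G x y 5)).ConnectedComponent,
      (∀ w ∈ distLevel G x y 4, (∃ h ∈ H.supp, G.Adj w h.1) →
        ∀ h ∈ H.supp, G.Adj w h.1) ∧
      ((∃ a, H.supp = {a}) ∨
       (∃ a b, a ≠ b ∧ G.Adj a.1 b.1 ∧ H.supp = {a, b})) := by
  have hadj : G.Adj x y := hM.1 hxy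
  have hstep : ∀ w h k : V, w ∈ distLevel G x y 4 → h ∈ distLevel G x y 5 →
      k ∈ distLevel G x y 5 → G.Adj w h → G.Adj h k → G.Adj w k :=
    fun w h k hw hh hk => adj_of_adj_of_P8_free hconn hP8 hDia hadj hrx hry hrny hw hh hk
  intro H
  have hreach : ∀ p ∈ H.supp, ∀ q ∈ H.supp, (G.induce (distLevel G x y 5)).Reachable p q := by
    intro p hp q hq
    rw [SimpleGraph.ConnectedComponent.mem_supp_iff] at hp hq
    exact SimpleGraph.ConnectedComponent.exact (hp.trans hq.symm)
  have hall : ∀ w ∈ distLevel G x y 4, (∃ h ∈ H.supp, G.Adj w h.1) →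
      ∀ h ∈ H.supp, G.Adj w h.1 := by
    rintro w hw ⟨h, hh, hwh⟩ k hk
    obtain ⟨p⟩ := hreach h hh k hk
    clear hh hk
    induction p with
    | nil => exact hwh
    | cons e p ih => exact ih (hstep _ _ _ hw (Subtype.coe_prop _) (Subtype.coe_prop _) hwh e)
  refine ⟨hall, ?_⟩
  obtain ⟨a, ha⟩ := H.nonempty_supp
  obtain ⟨w, haw, hw⟩ := exists_adj_pairDist_eq hconn (x := x) (y := y) (n := 4) a.2
  have hwall := hall w hw ⟨a, ha, haw.symm⟩
  have hclique : ∀ p ∈ H.supp, ∀ q ∈ H.supp, p ≠ q → G.Adj p.1 q.1 := by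
    intro p hp q hq hpq
    obtain ⟨s⟩ := hreach p hp q hq
    induction s with
    | nil => exact absurd rfl hpq
    | @cons p z q e s ih =>
      have hz : z ∈ H.supp := H.mem_supp_of_adj_mem_supp hp e
      by_cases hzq : z = q
      · exact hzq ▸ e
      · exact adj_of_diamond_free hDia e (hwall p hp).symm (hwall z hz).symm (ih hz hq hzq)
          (hwall q hq) fun heq => hpq (Subtype.ext heq)
  by_cases hsingle : ∃ b ∈ H.supp, b ≠ a
  · obtain ⟨b, hb, hba⟩ := hsingle
    refine Or.inr ⟨a, b, hba.symm, hclique a ha b hb hba.symm, ?_⟩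
    ext c
    simp only [Set.mem_insert_iff, Set.mem_singleton_iff]
    refine ⟨fun hc => ?_, ?_⟩
    · by_contra! hcab
      exact not_adj_of_K4_free hK4 (hwall a ha) (hwall b hb) (hwall c hc)
        (hclique a ha b hb hba.symm) (hclique a ha c hc hcab.1.symm)
        (hclique b hb c hc hcab.2.symm)
    · rintro (rfl | rfl) <;> assumption
  · push Not at hsingle
    refine Or.inl ⟨a, ?_⟩
    ext c
    exact ⟨hsingle c, fun hc => hc ▸ ha⟩
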